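/- arXiv:math/0701251 — 2 statements merged into one kernel-verified Lean document; each statement's English description precedes it below -/
import Mathlib

section
/- Let a_n be the coefficient of q^n in ∏_{m=1}^∞ (1 - q^m)^3. Then as N → ∞: (i) ∑_{n=0}^{N} |a_n| is asymptotically equivalent to 2N; (ii) ∑_{n=0}^{N} a_n^2 is asymptotically equivalent to (1/6)·(8N)^{3/2}; and (iii) max_{0 ≤ n ≤ N} |a_n| is asymptotically equivalent to (8N)^{1/2}. -/
open Filter

/-- The product of `1 - q^m` over `1 ≤ m ≤ n`. -/
def qFactor {R : Type*} [CommRing R] (q : R) (n : ℕ) : R := ∏ i ∈ Finset.range n, (1 - q ^ (i + 1))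

theorem qFactor_succ {R : Type*} [CommRing R] (q : R) (n : ℕ) :
    qFactor q (n + 1) = qFactor q n * (1 - q ^ (n + 1)) := Finset.prod_range_succ _ _

theorem choose_two_succ (k : ℕ) : (k + 1).choose 2 = k + k.choose 2 := by
  rw [Nat.choose_succ_succ' k 1, Nat.choose_one_right]

theorem two_mul_choose_two (k : ℕ) : 2 * (k + 1).choose 2 = k * (k + 1) := by
  induction k with
  | zero => rfl
  | succ k ih => rw [choose_two_succ, mul_add, ih]; ring

/-- The `q`-binomial theorem, with `u k` the inverse of `qFactor q k`. -/
theorem prod_add_mul_pow {R : Type*} [CommRing R] (q : R) (u : ℕ → R)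
    (hu : ∀ k, u k * qFactor q k = 1) (N : ℕ) (x y : R) :
    ∏ i ∈ Finset.range N, (y + x * q ^ i) =
      ∑ p ∈ Finset.HasAntidiagonal.antidiagonal N,
        qFactor q N * u p.1 * u p.2 * q ^ (p.1.choose 2) * x ^ p.1 * y ^ p.2 := by
  have h0 : u 0 = 1 := by simpa [qFactor] using hu 0
  have hs : ∀ k, u k = u (k + 1) * (1 - q ^ (k + 1)) := by
    intro k
    have h1 := hu k
    have h2 := hu (k + 1)
    rw [qFactor_succ] at h2
    linear_combination (-u k) * h2 + u (k+1) * (1 - q ^ (k + 1)) * h1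
  induction N generalizing x with
  | zero => simp [qFactor, h0]
  | succ N ih =>
    have e : ∏ i ∈ Finset.range (N + 1), (y + x * q ^ i) =
        (∏ i ∈ Finset.range N, (y + x * q * q ^ i)) * y +
        (∏ i ∈ Finset.range N, (y + x * q * q ^ i)) * x := by
      rw [Finset.prod_range_succ']
      simp only [pow_zero, mul_one, pow_succ', mul_assoc, mul_add]
    rw [e, ih (x * q), Finset.sum_mul, Finset.sum_mul]
    let F : ℕ × ℕ → R := fun p =>
      qFactor q N * (1 - q ^ p.2) * q ^ p.1 * u p.1 * u p.2 * q ^ (p.1.choose 2) * x ^ p.1 * y ^ p.2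
    let G : ℕ × ℕ → R := fun p =>
      qFactor q N * (1 - q ^ p.1) * u p.1 * u p.2 * q ^ (p.1.choose 2) * x ^ p.1 * y ^ p.2
    have hF : ∑ p ∈ Finset.HasAntidiagonal.antidiagonal (N + 1), F p =
        ∑ p ∈ Finset.HasAntidiagonal.antidiagonal N,
        qFactor q N * u p.1 * u p.2 * q ^ (p.1.choose 2) * (x * q) ^ p.1 * y ^ p.2 * y := by
      rw [Finset.Nat.sum_antidiagonal_succ']
      have : F (N + 1, 0) = 0 := by simp [F]
      rw [this, zero_add]
      refine Finset.sum_congr rfl fun p _ => ?_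
      simp only [F]
      rw [hs p.2]
      ring
    have hG : ∑ p ∈ Finset.HasAntidiagonal.antidiagonal (N + 1), G p =
        ∑ p ∈ Finset.HasAntidiagonal.antidiagonal N,
        qFactor q N * u p.1 * u p.2 * q ^ (p.1.choose 2) * (x * q) ^ p.1 * y ^ p.2 * x := by
      rw [Finset.Nat.sum_antidiagonal_succ]
      have : G (0, N + 1) = 0 := by simp [G]
      rw [this, zero_add]
      refine Finset.sum_congr rfl fun p _ => ?_
      simp only [G]
      rw [hs p.1, choose_two_succ]
      ring
    rw [← hF, ← hG, ← Finset.sum_add_distrib]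
    refine Finset.sum_congr rfl fun p hp => ?_
    rw [Finset.HasAntidiagonal.mem_antidiagonal] at hp
    simp only [F, G]
    rw [qFactor_succ, ← hp]
    ring

theorem prod_pow_sub_lower {R : Type*} [CommRing R] (q : R) (n : ℕ) :
    ∏ i ∈ Finset.range n, (q ^ n - q ^ i) = (-1) ^ n * q ^ (n.choose 2) * qFactor q n := by
  induction n with
  | zero => simp [qFactor]
  | succ n ih =>
    have h : ∏ i ∈ Finset.range n, (q ^ (n + 1) - q ^ (i + 1)) =
        q ^ n * ∏ i ∈ Finset.range n, (q ^ n - q ^ i) := by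
      have h' : ∏ _i ∈ Finset.range n, q = q ^ n := by simp
      rw [← h', ← Finset.prod_mul_distrib, h']
      exact Finset.prod_congr rfl fun i _ => by ring
    rw [Finset.prod_range_succ', h, ih, qFactor_succ, choose_two_succ]
    ring

theorem prod_pow_sub_upper {R : Type*} [CommRing R] (q : R) (n : ℕ) :
    ∏ i ∈ Finset.range n, (q ^ n - q ^ (n + 1 + i)) = q ^ (n * n) * qFactor q n := by
  have h : ∏ _i ∈ Finset.range n, q ^ n = q ^ (n * n) := by simp [pow_mul]
  rw [qFactor, ← h, ← Finset.prod_mul_distrib]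
  exact Finset.prod_congr rfl fun i _ => by ring

open Polynomial in
/-- A finite form of Jacobi's identity for `∏ (1 - q^m)^3`. -/
theorem qFactor_sq {R : Type*} [CommRing R] [IsDomain R] (q : R) (hq : q ≠ 0) (u : ℕ → R)
    (hu : ∀ k, u k * qFactor q k = 1) (n : ℕ) :
    qFactor q n ^ 2 = ∑ k ∈ Finset.range (n + 1), (-1) ^ k * (2 * k + 1) *
      q ^ ((k + 1).choose 2) * (qFactor q (2 * n + 1) * u (n - k) * u (n + 1 + k)) := by
  have hC : ∀ k, C (qFactor q k) = qFactor (C q) k := fun k => by simp [qFactor, map_prod]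
  have key := prod_add_mul_pow (C q) (fun k => C (u k))
    (fun k => by rw [← hC, ← C_mul, hu, C_1]) (2 * n + 1) (-X) (C q ^ n)
  have hR : ∀ p : ℕ × ℕ, qFactor (C q) (2 * n + 1) * C (u p.1) * C (u p.2) *
      C q ^ (p.1.choose 2) * (-X) ^ p.1 * (C q ^ n) ^ p.2 =
      C (qFactor q (2 * n + 1) * u p.1 * u p.2 * q ^ (p.1.choose 2) * (-1) ^ p.1 * (q ^ n) ^ p.2) *
        X ^ p.1 := by
    intro p
    rw [neg_pow, ← hC]
    simp only [map_mul, map_pow, map_neg, map_one]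
    ring
  have hL : ∏ i ∈ Finset.range (2 * n + 1), (C q ^ n + -X * C q ^ i) =
      (∏ i ∈ Finset.range n, (C q ^ n + -X * C q ^ i)) *
      (∏ i ∈ Finset.range n, (C q ^ n + -X * C q ^ (n + 1 + i))) * C (q ^ n) * (1 - X) := by
    rw [show 2 * n + 1 = n + 1 + n by ring, Finset.prod_range_add, Finset.prod_range_succ, C_pow]
    ring
  simp only [hR] at key
  rw [hL] at key
  have hd : ∀ F : R[X], eval 1 (derivative (F * (1 - X))) = -eval 1 F := fun F => by
    simp [derivative_mul]
  have key2 := congrArg (fun f => eval 1 (derivative f)) key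
  simp only [hd, derivative_sum, derivative_C_mul_X_pow, eval_finsetSum,
    eval_sub, eval_mul, eval_X, eval_C, eval_pow, one_pow, mul_one,
    eval_prod, neg_mul, one_mul, ← sub_eq_add_neg] at key2
  rw [prod_pow_sub_lower, prod_pow_sub_upper] at key2
  rw [Finset.Nat.sum_antidiagonal_eq_sum_range_succ_mk,
    show (2 * n + 1).succ = (n + 1) + (n + 1) by simp; ring, Finset.sum_range_add,
    ← Finset.sum_range_reflect, ← Finset.sum_add_distrib] at key2
  have hE : (-1) ^ (n + 1) * q ^ (n.choose 2 + n * (n + 1)) ≠ 0 :=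
    mul_ne_zero (pow_ne_zero _ (neg_ne_zero.2 one_ne_zero)) (pow_ne_zero _ hq)
  apply mul_left_cancel₀ hE
  rw [Finset.mul_sum]
  refine Eq.trans ?_ (key2.trans (Finset.sum_congr rfl fun k hk => ?_))
  · ring
  · obtain ⟨m, rfl⟩ : ∃ m, n = k + m :=
      Nat.exists_eq_add_of_le (by simpa [Nat.lt_succ_iff] using hk)
    have e1 : k + m + 1 - 1 - k = m := by omega
    have e2 : 2 * (k + m) + 1 - m = k + m + 1 + k := by omega
    have e3 : 2 * (k + m) + 1 - (k + m + 1 + k) = m := by omega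
    have e4 : k + m - k = m := by omega
    simp only [e1, e2, e3, e4]
    have c : ∀ j : ℕ, (j.choose 2 : ℤ) * 2 = j * (j - 1) := fun j => by
      cases j with
      | zero => simp
      | succ j => have := two_mul_choose_two j; zify at this; push_cast; linarith
    have f1 : (k + m).choose 2 + (k + m) * (k + m + 1) + (k + 1).choose 2 =
      m.choose 2 + (k + m) * (k + m + 1 + k) := by
      have := c (k + m); have := c (k + 1); have := c m
      zify; push_cast at *; nlinarith
    have f2 : (k + m).choose 2 + (k + m) * (k + m + 1) + (k + 1).choose 2 =
      (k + m + 1 + k).choose 2 + (k + m) * m := by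
      have := c (k + m); have := c (k + 1); have := c (k + m + 1 + k)
      zify; push_cast at *; nlinarith
    have g1 := congrArg (fun j => q ^ j) f1
    have g2 := congrArg (fun j => q ^ j) f2
    have s : ((-1 : R) ^ k) ^ 2 = 1 := by rw [← pow_mul, mul_comm, pow_mul]; simp
    simp only [← pow_mul] at g1 g2 ⊢
    push_cast
    linear_combination qFactor q (2 * (k + m) + 1) * u m * u (k + m + 1 + k) * (-1) ^ m *
      (-(m : R) * g1 + ((-1) ^ k) ^ 2 * (2 * k + 1 + m) * g2 -
        m * q ^ ((k + m).choose 2 + (k + m) * (k + m + 1) + (k + 1).choose 2) * s)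

theorem X_pow_dvd_qFactor_mul_sub_one (u : ℕ → PowerSeries ℤ)
    (hu : ∀ k, u k * qFactor PowerSeries.X k = 1) (m M : ℕ) (h : m ≤ M) :
    (PowerSeries.X : PowerSeries ℤ) ^ (m + 1) ∣ qFactor PowerSeries.X M * u m - 1 := by
  induction M, h using Nat.le_induction with
  | base => rw [mul_comm, hu, sub_self]; exact dvd_zero _
  | succ M hM ih =>
    have : qFactor PowerSeries.X (M + 1) * u m - 1 = (qFactor PowerSeries.X M * u m - 1) -
      PowerSeries.X ^ (M + 1) * (qFactor PowerSeries.X M * u m) := by rw [qFactor_succ]; ring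
    rw [this]
    exact dvd_sub ih (dvd_mul_of_dvd_left (pow_dvd_pow _ (by omega)) _)

theorem X_pow_dvd_jacobi (n : ℕ) : (PowerSeries.X : PowerSeries ℤ) ^ (n + 1) ∣
    qFactor PowerSeries.X n ^ 3 - ∑ k ∈ Finset.range (n + 1),
      (-1) ^ k * (2 * (k : PowerSeries ℤ) + 1) *
      PowerSeries.X ^ ((k + 1).choose 2) := by
  have hunit : ∀ k, ∃ v : PowerSeries ℤ, v * qFactor PowerSeries.X k = 1 := by
    intro k
    refine (PowerSeries.isUnit_iff_constantCoeff.2 ?_).exists_left_inv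
    simp [qFactor, map_prod]
  choose u hu using hunit
  rw [pow_succ (qFactor _ _) 2, qFactor_sq PowerSeries.X PowerSeries.X_ne_zero u hu n, Finset.sum_mul,
    ← Finset.sum_sub_distrib]
  refine Finset.dvd_sum fun k hk => ?_
  have hk' : k ≤ n := by simpa [Nat.lt_succ_iff] using hk
  obtain ⟨A, hA⟩ := X_pow_dvd_qFactor_mul_sub_one u hu (n - k) n (by omega)
  obtain ⟨B, hB⟩ := X_pow_dvd_qFactor_mul_sub_one u hu (n + 1 + k) (2 * n + 1) (by omega)
  have hAB : (PowerSeries.X : PowerSeries ℤ) ^ (n - k + 1) ∣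
      qFactor PowerSeries.X (2 * n + 1) * u (n - k) * u (n + 1 + k) * qFactor PowerSeries.X n - 1 := by
    have : qFactor PowerSeries.X (2 * n + 1) * u (n - k) * u (n + 1 + k) * qFactor PowerSeries.X n - 1
      = (qFactor PowerSeries.X n * u (n - k) - 1) * (qFactor PowerSeries.X (2 * n + 1) * u (n + 1 + k))
       + (qFactor PowerSeries.X (2 * n + 1) * u (n + 1 + k) - 1) := by ring
    rw [this]
    exact dvd_add (dvd_mul_of_dvd_left ⟨A, hA⟩ _) ((pow_dvd_pow _ (by omega)).trans ⟨B, hB⟩)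
  have h2 : n + 1 ≤ (k + 1).choose 2 + (n - k + 1) := by
    have := choose_two_succ k
    omega
  refine (pow_dvd_pow _ h2).trans ?_
  rw [pow_add]
  obtain ⟨D, hD⟩ := hAB
  exact ⟨(-1) ^ k * (2 * (k : PowerSeries ℤ) + 1) * D, by
    linear_combination ((-1) ^ k * (2 * (k : PowerSeries ℤ) + 1) *
      PowerSeries.X ^ ((k + 1).choose 2)) * hD⟩

/-- **Jacobi's identity**, read off coefficientwise. -/
theorem coeff_prod_cube (n : ℕ) :
    ((∏ m ∈ Finset.Icc 1 n, ((1 : Polynomial ℤ) - Polynomial.X ^ m)) ^ 3).coeff n =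
      ∑ k ∈ Finset.range (n + 1), if n = (k + 1).choose 2 then (-1) ^ k * (2 * (k : ℤ) + 1) else 0 := by
  have h := PowerSeries.X_pow_dvd_iff.1 (X_pow_dvd_jacobi n) n (Nat.lt_succ_self n)
  rw [map_sub, sub_eq_zero, map_sum] at h
  have e : (((∏ m ∈ Finset.Icc 1 n, ((1 : Polynomial ℤ) - Polynomial.X ^ m)) ^ 3 : Polynomial ℤ) :
      PowerSeries ℤ) = qFactor PowerSeries.X n ^ 3 := by
    have e1 : ∏ m ∈ Finset.Icc 1 n, ((1 : Polynomial ℤ) - Polynomial.X ^ m) =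
        qFactor Polynomial.X n := by
      rw [qFactor, Finset.range_eq_Ico, Finset.prod_Ico_add' (fun i => 1 - Polynomial.X ^ i) 0 n 1]
      rfl
    rw [e1, qFactor, qFactor, ← Polynomial.coeToPowerSeries.ringHom_apply, map_pow, map_prod]
    simp
  rw [← Polynomial.coeff_coe, e, h]
  refine Finset.sum_congr rfl fun k _ => ?_
  have : (-1) ^ k * (2 * (k : PowerSeries ℤ) + 1) = PowerSeries.C ((-1) ^ k * (2 * (k : ℤ) + 1)) := by
    simp
  rw [this, PowerSeries.coeff_C_mul_X_pow]

theorem strictMono_choose_two : StrictMono fun k : ℕ => (k + 1).choose 2 :=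
  strictMono_nat_of_lt_succ fun k => by
    have := choose_two_succ (k + 1)
    omega

theorem exists_triangular_bracket (N : ℕ) :
    ∃ k : ℕ, (k + 1).choose 2 ≤ N ∧ N < (k + 2).choose 2 := by
  induction N with
  | zero => exact ⟨0, by decide, by decide⟩
  | succ N ih =>
    obtain ⟨k, h1, h2⟩ := ih
    have := choose_two_succ (k + 2)
    rcases Nat.lt_or_ge (N + 1) ((k + 2).choose 2) with h | h
    · exact ⟨k, by omega, h⟩
    · exact ⟨k + 1, h, by show _ < (k + 2 + 1).choose 2; omega⟩

section Coefficients

variable {a : ℕ → ℤ}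

theorem coeff_triangular
    (ha : ∀ n, a n = ∑ k ∈ Finset.range (n + 1),
      if n = (k + 1).choose 2 then (-1) ^ k * (2 * (k : ℤ) + 1) else 0) (k : ℕ) :
    a ((k + 1).choose 2) = (-1) ^ k * (2 * (k : ℤ) + 1) := by
  rw [ha, Finset.sum_eq_single k, if_pos rfl]
  · exact fun j _ hj => if_neg fun h => hj (strictMono_choose_two.injective h).symm
  · intro h
    exact absurd (Finset.mem_range.2 (Nat.lt_succ_of_le (strictMono_choose_two.le_apply))) h

theorem coeff_eq_zero
    (ha : ∀ n, a n = ∑ k ∈ Finset.range (n + 1),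
      if n = (k + 1).choose 2 then (-1) ^ k * (2 * (k : ℤ) + 1) else 0) {n : ℕ}
    (hn : ∀ k : ℕ, n ≠ (k + 1).choose 2) : a n = 0 := by
  rw [ha]
  exact Finset.sum_eq_zero fun k _ => if_neg (hn k)

theorem sum_coeff_eq
    (ha : ∀ n, a n = ∑ k ∈ Finset.range (n + 1),
      if n = (k + 1).choose 2 then (-1) ^ k * (2 * (k : ℤ) + 1) else 0) (f : ℤ → ℝ) (hf : f 0 = 0)
    {N K : ℕ} (h1 : (K + 1).choose 2 ≤ N) (h2 : N < (K + 2).choose 2) :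
    ∑ n ∈ Finset.range (N + 1), f (a n) =
      ∑ k ∈ Finset.range (K + 1), f ((-1) ^ k * (2 * (k : ℤ) + 1)) := by
  simp only [← coeff_triangular ha]
  rw [← Finset.sum_image (f := fun n => f (a n)) (g := fun k : ℕ => (k + 1).choose 2)
    strictMono_choose_two.injective.injOn]
  symm
  apply Finset.sum_subset
  · intro n hn
    obtain ⟨k, hk, rfl⟩ := Finset.mem_image.1 hn
    have := strictMono_choose_two.monotone (Nat.lt_succ_iff.1 (Finset.mem_range.1 hk))
    exact Finset.mem_range.2 (by omega)
  · intro n hn hn'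
    rw [coeff_eq_zero ha, hf]
    rintro k rfl
    refine hn' (Finset.mem_image.2 ⟨k, Finset.mem_range.2 ?_, rfl⟩)
    exact strictMono_choose_two.lt_iff_lt.1 ((Nat.lt_succ_iff.1 (Finset.mem_range.1 hn)).trans_lt h2)

theorem natAbs_sign_mul (k : ℕ) : ((-1) ^ k * (2 * (k : ℤ) + 1)).natAbs = 2 * k + 1 := by
  rw [Int.natAbs_mul, Int.natAbs_pow]
  simp only [Int.natAbs_neg, Int.natAbs_one, one_pow, one_mul]
  omega

theorem sup_natAbs_coeff_eq
    (ha : ∀ n, a n = ∑ k ∈ Finset.range (n + 1),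
      if n = (k + 1).choose 2 then (-1) ^ k * (2 * (k : ℤ) + 1) else 0)
    {N K : ℕ} (h1 : (K + 1).choose 2 ≤ N) (h2 : N < (K + 2).choose 2) :
    ((Finset.range (N + 1)).sup fun n => (a n).natAbs) = 2 * K + 1 := by
  apply le_antisymm
  · refine Finset.sup_le fun n hn => ?_
    by_cases h : ∀ k : ℕ, n ≠ (k + 1).choose 2
    · simp [coeff_eq_zero ha h]
    · push Not at h
      obtain ⟨k, rfl⟩ := h
      rw [coeff_triangular ha, natAbs_sign_mul]
      have : k < K + 1 := strictMono_choose_two.lt_iff_lt.1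
        ((Nat.lt_succ_iff.1 (Finset.mem_range.1 hn)).trans_lt h2)
      omega
  · rw [← natAbs_sign_mul, ← coeff_triangular ha]
    exact Finset.le_sup (f := fun n => (a n).natAbs) (Finset.mem_range.2 (Nat.lt_succ_of_le h1))

end Coefficients

theorem sum_odd (M : ℕ) : ∑ k ∈ Finset.range M, (2 * (k : ℝ) + 1) = (M : ℝ) ^ 2 := by
  induction M with
  | zero => simp
  | succ M ih => rw [Finset.sum_range_succ, ih]; push_cast; ring

theorem sum_odd_sq (M : ℕ) :
    ∑ k ∈ Finset.range M, (2 * (k : ℝ) + 1) ^ 2 = M * (4 * (M : ℝ) ^ 2 - 1) / 3 := by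
  induction M with
  | zero => simp
  | succ M ih => rw [Finset.sum_range_succ, ih]; push_cast; ring

theorem tendsto_inv_sqrt_two_mul :
    Tendsto (fun N : ℕ => (√(2 * (N : ℝ)))⁻¹) atTop (nhds 0) :=
  tendsto_inv_atTop_zero.comp (Real.tendsto_sqrt_atTop.comp
    (tendsto_natCast_atTop_atTop.const_mul_atTop two_pos))

theorem tendsto_triangular_root {K : ℕ → ℕ} (h1 : ∀ N, (K N + 1).choose 2 ≤ N)
    (h2 : ∀ N, N < (K N + 2).choose 2) :
    Tendsto (fun N : ℕ => ((K N : ℝ) + 1) / √(2 * (N : ℝ))) atTop (nhds 1) := by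
  have hl : Tendsto (fun N : ℕ => 1 - (√(2 * (N : ℝ)))⁻¹) atTop (nhds 1) := by
    simpa using tendsto_inv_sqrt_two_mul.const_sub 1
  have hu : Tendsto (fun N : ℕ => 1 + (√(2 * (N : ℝ)))⁻¹) atTop (nhds 1) := by
    simpa using tendsto_inv_sqrt_two_mul.const_add 1
  refine tendsto_of_tendsto_of_tendsto_of_le_of_le' hl hu ?_ ?_
  all_goals
    filter_upwards [eventually_gt_atTop 0] with N hN
    have hs : 0 < √(2 * (N : ℝ)) := Real.sqrt_pos.2 (by positivity)
    have hs2 : √(2 * (N : ℝ)) ^ 2 = 2 * N := Real.sq_sqrt (by positivity)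
    have b1 : (K N : ℝ) * (K N + 1) ≤ 2 * N := by
      exact_mod_cast (two_mul_choose_two (K N)).symm.le.trans (Nat.mul_le_mul_left 2 (h1 N))
    have b2 : 2 * (N : ℝ) ≤ (K N + 1) * (K N + 2) := by
      exact_mod_cast (Nat.mul_le_mul_left 2 (h2 N).le).trans (two_mul_choose_two (K N + 1)).le
    have hK : (0 : ℝ) ≤ K N := Nat.cast_nonneg _
    have e : √(2 * (N : ℝ)) * (√(2 * (N : ℝ)))⁻¹ = 1 := mul_inv_cancel₀ hs.ne'
  · rw [le_div_iff₀ hs, sub_mul, mul_comm (_⁻¹), e]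
    nlinarith
  · rw [div_le_iff₀ hs, add_mul, mul_comm (_⁻¹), e]
    nlinarith

/-- With `a n` the coefficient of `q^n` in `∏ (1 - q^m)^3`, as `N → ∞`:
`∑_{n ≤ N} |a_n| ~ 2N`, `∑_{n ≤ N} a_n^2 ~ (1/6)(8N)^{3/2}` and
`max_{n ≤ N} |a_n| ~ (8N)^{1/2}`. -/
theorem stmt_10 (a : ℕ → ℤ)
    (ha : ∀ n N : ℕ, n ≤ N →
      a n = (((∏ m ∈ Finset.Icc 1 N, ((1 : Polynomial ℤ) - Polynomial.X ^ m)) ^ 3).coeff n)) :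
    Tendsto
      (fun N : ℕ => (∑ n ∈ Finset.range (N + 1), (|a n| : ℝ)) / (2 * N))
      atTop (nhds 1) ∧
    Tendsto
      (fun N : ℕ => (∑ n ∈ Finset.range (N + 1), ((a n : ℝ)) ^ 2) /
        ((1 / 6) * ((8 * N : ℝ)) ^ ((3 : ℝ) / 2)))
      atTop (nhds 1) ∧
    Tendsto
      (fun N : ℕ => (((Finset.range (N + 1)).sup fun n => (a n).natAbs : ℕ) : ℝ) /
        Real.sqrt (8 * N))
      atTop (nhds 1) := by
  have hc := fun n => (ha n n le_rfl).trans (coeff_prod_cube n)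
  choose K h1 h2 using exists_triangular_bracket
  have ht := tendsto_triangular_root h1 h2
  have hi := tendsto_inv_sqrt_two_mul
  have habs : ∀ k : ℕ, |(((-1) ^ k * (2 * (k : ℤ) + 1) : ℤ) : ℝ)| = 2 * (k : ℝ) + 1 := fun k => by
    rw [← Int.cast_abs, Int.abs_eq_natAbs, natAbs_sign_mul]
    push_cast
    rfl
  have hsqrt : ∀ N : ℕ, √(8 * (N : ℝ)) = 2 * √(2 * (N : ℝ)) := fun N => by
    rw [show (8 * (N : ℝ)) = 2 ^ 2 * (2 * N) by ring, Real.sqrt_mul (by positivity),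
      Real.sqrt_sq two_pos.le]
  refine ⟨?_, ?_, ?_⟩
  · refine Tendsto.congr' ?_ ((ht.pow 2).mono_right (le_of_eq (by norm_num)))
    filter_upwards with N
    rw [sum_coeff_eq hc (fun z => |(z : ℝ)|) (by simp) (h1 N) (h2 N)]
    simp only [habs]
    rw [sum_odd, div_pow, Real.sq_sqrt (by positivity)]
    push_cast
    rfl
  · have hlim := (ht.pow 3).sub ((ht.mul (hi.pow 2)).mul_const (1 / 4))
    refine Tendsto.congr' ?_ (hlim.mono_right (le_of_eq (by norm_num)))
    filter_upwards [eventually_gt_atTop 0] with N hN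
    have hs : 0 < √(2 * (N : ℝ)) := Real.sqrt_pos.2 (by positivity)
    have hrpow : (8 * (N : ℝ)) ^ ((3 : ℝ) / 2) = 8 * √(2 * (N : ℝ)) ^ 3 := by
      have h8 : (0 : ℝ) ≤ 8 * N := by positivity
      rw [show (3 : ℝ) / 2 = 1 / 2 * (3 : ℕ) by norm_num, Real.rpow_mul h8, Real.rpow_natCast,
        ← Real.sqrt_eq_rpow, hsqrt]
      ring
    rw [sum_coeff_eq hc (fun z => (z : ℝ) ^ 2) (by simp) (h1 N) (h2 N), hrpow]
    simp only [← sq_abs (Int.cast _), habs]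
    rw [sum_odd_sq]
    push_cast
    field_simp
    ring
  · have hlim := ht.sub (hi.mul_const (1 / 2))
    refine Tendsto.congr' ?_ (hlim.mono_right (le_of_eq (by norm_num)))
    filter_upwards [eventually_gt_atTop 0] with N hN
    have hs : 0 < √(2 * (N : ℝ)) := Real.sqrt_pos.2 (by positivity)
    rw [sup_natAbs_coeff_eq hc (h1 N) (h2 N), hsqrt]
    push_cast
    field_simp
    ring
end

section
/- Let a_n be the coefficient of q^n in ∏_{m=1}^∞ (1 - q^m)^3. Let f : ℕ → ℤ be the multiplicative arithmetic function determined on prime powers p^r (r ≥ 1) by: f(p^r) = p^{r/2} if p ≡ 1 (mod 4) and r is even; f(p^r) = (-1)^{r/2} p^{r/2} if p ≡ 3 (mod 4) and r is even; and f(p^r) = 0 otherwise. Then a_n = f(8n + 1) for all n ≥ 0. -/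
/-- The finite `q`-Pochhammer symbol `(q; q)_n = ∏_{i=1}^n (1 - q^i)`. -/
def qPochhammer {R : Type*} [CommRing R] (q : R) (n : ℕ) : R :=
  ∏ m ∈ Finset.Icc 1 n, (1 - q ^ m)

theorem qPochhammer_zero {R : Type*} [CommRing R] (q : R) : qPochhammer q 0 = 1 := by
  simp [qPochhammer]

theorem qPochhammer_succ {R : Type*} [CommRing R] (q : R) (n : ℕ) :
    qPochhammer q (n + 1) = qPochhammer q n * (1 - q ^ (n + 1)) := by
  simp [qPochhammer, Finset.prod_Icc_succ_top]

theorem qPochhammer_eq_prod_range {R : Type*} [CommRing R] (q : R) (n : ℕ) :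
    qPochhammer q n = ∏ i ∈ Finset.range n, (1 - q ^ (i + 1)) := by
  induction n with
  | zero => simp [qPochhammer]
  | succ n ih => rw [qPochhammer_succ, Finset.prod_range_succ, ih]

/-- The Gaussian binomial coefficient, defined by the `q`-Pascal recursion. -/
def gaussBinom {R : Type*} [CommRing R] (q : R) : ℕ → ℕ → R
  | _, 0 => 1
  | 0, _ + 1 => 0
  | n + 1, k + 1 => gaussBinom q n k + q ^ (k + 1) * gaussBinom q n (k + 1)

theorem gaussBinom_zero_right {R : Type*} [CommRing R] (q : R) (n : ℕ) :
    gaussBinom q n 0 = 1 := by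
  cases n <;> rfl

theorem gaussBinom_succ_succ {R : Type*} [CommRing R] (q : R) (n k : ℕ) :
    gaussBinom q (n + 1) (k + 1) =
      gaussBinom q n k + q ^ (k + 1) * gaussBinom q n (k + 1) := rfl

theorem gaussBinom_eq_zero_of_lt {R : Type*} [CommRing R] (q : R) {n k : ℕ} (h : n < k) :
    gaussBinom q n k = 0 := by
  induction n generalizing k with
  | zero =>
    obtain ⟨k, rfl⟩ := Nat.exists_eq_succ_of_ne_zero h.ne'
    rfl
  | succ n ih =>
    obtain ⟨k, rfl⟩ := Nat.exists_eq_succ_of_ne_zero (Nat.ne_zero_of_lt h)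
    rw [Nat.succ_eq_add_one, gaussBinom_succ_succ, ih (by omega), ih (by omega)]
    simp

theorem gaussBinom_self {R : Type*} [CommRing R] (q : R) (n : ℕ) : gaussBinom q n n = 1 := by
  induction n with
  | zero => rfl
  | succ n ih => simp [gaussBinom_succ_succ, ih, gaussBinom_eq_zero_of_lt]

theorem qPochhammer_mul_qPochhammer_mul_gaussBinom {R : Type*} [CommRing R] (q : R) (n k : ℕ) :
    qPochhammer q k * qPochhammer q n * gaussBinom q (n + k) k = qPochhammer q (n + k) := by
  induction n generalizing k with
  | zero => simp [qPochhammer_zero, gaussBinom_self]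
  | succ n ihn =>
    induction k with
    | zero => simp [qPochhammer_zero, gaussBinom_zero_right]
    | succ k ihk =>
      have h := ihn (k + 1)
      rw [show n + 1 + (k + 1) = (n + k + 1) + 1 by ring, gaussBinom_succ_succ,
        qPochhammer_succ q (n + k + 1)]
      rw [show n + 1 + k = n + k + 1 by ring] at ihk
      rw [← add_assoc] at h
      rw [qPochhammer_succ q n] at ihk ⊢
      rw [qPochhammer_succ q k] at h ⊢
      linear_combination (1 - q ^ (k + 1)) * ihk + q ^ (k + 1) * (1 - q ^ (n + 1)) * h

/-- The homogeneous `q`-binomial theorem. -/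
theorem prod_add_mul_pow_eq_sum_gaussBinom {R : Type*} [CommRing R] (q a z : R) (M : ℕ) :
    ∏ i ∈ Finset.range M, (a + z * q ^ i) =
      ∑ j ∈ Finset.range (M + 1), q ^ (j.choose 2) * gaussBinom q M j * z ^ j * a ^ (M - j) := by
  induction M generalizing z with
  | zero => simp [gaussBinom_zero_right]
  | succ M ih =>
    rw [Finset.prod_range_succ']
    have h : ∏ i ∈ Finset.range M, (a + z * q ^ (i + 1)) =
        ∏ i ∈ Finset.range M, (a + (z * q) * q ^ i) :=
      Finset.prod_congr rfl fun i _ ↦ by ring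
    rw [h, ih, Finset.sum_range_succ' _ (M + 1)]
    have hsplit : ∀ j ∈ Finset.range (M + 1),
        q ^ ((j + 1).choose 2) * gaussBinom q (M + 1) (j + 1) * z ^ (j + 1) *
          a ^ (M + 1 - (j + 1)) =
        z * (q ^ (j.choose 2) * gaussBinom q M j * (z * q) ^ j * a ^ (M - j)) +
        q ^ ((j + 1).choose 2) * gaussBinom q M (j + 1) * (z * q) ^ (j + 1) * a ^ (M - j) := by
      intro j _
      rw [gaussBinom_succ_succ, Nat.choose_succ_succ' j 1, Nat.choose_one_right,
        Nat.add_sub_add_right]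
      ring
    rw [Finset.sum_congr rfl hsplit, Finset.sum_add_distrib, ← Finset.mul_sum,
      Finset.sum_range_succ _ M, Finset.sum_range_succ
        (fun j ↦ q ^ ((j + 1).choose 2) * gaussBinom q M (j + 1) * (z * q) ^ (j + 1) * a ^ (M - j)),
      gaussBinom_eq_zero_of_lt q (Nat.lt_succ_self M)]
    rw [← Finset.sum_range_succ
      (fun j ↦ q ^ (j.choose 2) * gaussBinom q M j * (z * q) ^ j * a ^ (M - j)), mul_add]
    have hshift : ∑ j ∈ Finset.range M,
          q ^ ((j + 1).choose 2) * gaussBinom q M (j + 1) * (z * q) ^ (j + 1) * a ^ (M - j) +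
          a ^ (M + 1) =
        a * ∑ j ∈ Finset.range (M + 1),
          q ^ (j.choose 2) * gaussBinom q M j * (z * q) ^ j * a ^ (M - j) := by
      rw [Finset.sum_range_succ', mul_add, Finset.mul_sum]
      congr 1
      · refine Finset.sum_congr rfl fun j hj ↦ ?_
        rw [show M - j = (M - (j + 1)) + 1 by have := Finset.mem_range.1 hj; omega]
        ring
      · simp [gaussBinom_zero_right, pow_succ']
    simp only [pow_zero, mul_one, gaussBinom_zero_right, Nat.choose_zero_succ, one_mul, mul_zero,
      zero_mul, add_zero, Nat.sub_zero]
    linear_combination -hshift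

theorem map_gaussBinom {R S : Type*} [CommRing R] [CommRing S] (φ : R →+* S) (q : R) (n k : ℕ) :
    φ (gaussBinom q n k) = gaussBinom (φ q) n k := by
  induction n generalizing k with
  | zero => cases k <;> simp [gaussBinom]
  | succ n ih => cases k <;> simp [gaussBinom, ih]

theorem prod_range_pow_sub_pow {R : Type*} [CommRing R] (q : R) (n : ℕ) :
    ∏ i ∈ Finset.range n, (q ^ n - q ^ i) = (-1) ^ n * q ^ (n.choose 2) * qPochhammer q n := by
  have h : ∀ i ∈ Finset.range n,
      q ^ n - q ^ i = -1 * (q ^ i * (1 - q ^ (n - 1 - i + 1))) := by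
    intro i hi
    have hi' := Finset.mem_range.1 hi
    rw [mul_sub, ← pow_add, show i + (n - 1 - i + 1) = n by omega]
    ring
  rw [Finset.prod_congr rfl h, Finset.prod_mul_distrib, Finset.prod_mul_distrib,
    Finset.prod_range_reflect (fun i ↦ 1 - q ^ (i + 1)), ← qPochhammer_eq_prod_range,
    Finset.prod_pow_eq_pow_sum, Finset.sum_range_id, ← Nat.choose_two_right]
  simp [mul_assoc]

theorem prod_range_pow_sub_pow_add {R : Type*} [CommRing R] (q : R) (n : ℕ) :
    ∏ i ∈ Finset.range n, (q ^ n - q ^ (n + 1 + i)) = q ^ (n * n) * qPochhammer q n := by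
  have h : ∀ i ∈ Finset.range n,
      q ^ n - q ^ (n + 1 + i) = q ^ n * (1 - q ^ (i + 1)) := fun i _ ↦ by ring
  rw [Finset.prod_congr rfl h, Finset.prod_mul_distrib, ← qPochhammer_eq_prod_range]
  simp [← pow_mul]

open Polynomial in
/-- The derivative of the homogeneous `q`-binomial theorem at the root `z = 1`. -/
theorem sum_range_mul_gaussBinom_mul_pow {R : Type*} [CommRing R] (q : R) (n : ℕ) :
    ∑ j ∈ Finset.range (2 * n + 1 + 1), (-1) ^ j * j * gaussBinom q (2 * n + 1) j *
        q ^ (j.choose 2 + n * (2 * n + 1 - j)) =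
      (-1) ^ (n + 1) * q ^ (n.choose 2 + n + n * n) * qPochhammer q n ^ 2 := by
  have key := congrArg (fun p ↦ (derivative p).eval 1)
    (prod_add_mul_pow_eq_sum_gaussBinom (C q) (C q ^ n) (-X) (2 * n + 1))
  have hterm : ∀ j, C q ^ (j.choose 2) * gaussBinom (C q) (2 * n + 1) j * (-X) ^ j *
      (C q ^ n) ^ (2 * n + 1 - j) =
      C ((-1) ^ j * gaussBinom q (2 * n + 1) j * q ^ (j.choose 2 + n * (2 * n + 1 - j))) *
        X ^ j := by
    intro j
    rw [neg_pow, ← map_gaussBinom C, pow_add, pow_mul]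
    simp only [map_mul, map_pow, map_neg, map_one]
    ring
  simp only [hterm] at key
  rw [show 2 * n + 1 = (n + 1) + n by ring, Finset.prod_range_add, Finset.prod_range_succ,
    show (n + 1) + n = 2 * n + 1 by ring] at key
  rw [derivative_sum, eval_finsetSum] at key
  simp only [derivative_C_mul, derivative_X_pow, eval_C, eval_mul, eval_natCast,
    eval_pow, eval_X, one_pow, mul_one, map_natCast] at key
  trans
  · refine Eq.trans (Finset.sum_congr rfl fun j _ ↦ ?_) key.symm
    ring
  · simp [eval_prod, ← sub_eq_add_neg, prod_range_pow_sub_pow, prod_range_pow_sub_pow_add]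
    ring

/-- A finite form of Jacobi's identity for the cube of the Euler product. -/
theorem sum_range_mul_gaussBinom {R : Type*} [CommRing R] [IsDomain R] {q : R} (hq : q ≠ 0)
    (n : ℕ) :
    ∑ k ∈ Finset.range (n + 1), (-1) ^ k * q ^ ((k + 1).choose 2) *
        ((n + 1 + k : R) * gaussBinom q (2 * n + 1) (n + 1 + k) -
          (n - k : R) * gaussBinom q (2 * n + 1) (n - k)) =
      qPochhammer q n ^ 2 := by
  have key := sum_range_mul_gaussBinom_mul_pow q n
  rw [show 2 * n + 1 + 1 = (n + 1) + (n + 1) by ring, Finset.sum_range_add,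
    ← Finset.sum_range_reflect, ← Finset.sum_add_distrib] at key
  have hunit : (-1 : R) ^ (n + 1) * q ^ (n.choose 2 + n + n * n) ≠ 0 :=
    mul_ne_zero (pow_ne_zero _ (neg_ne_zero.2 one_ne_zero)) (pow_ne_zero _ hq)
  refine mul_left_cancel₀ hunit ?_
  rw [← key, Finset.mul_sum]
  refine Finset.sum_congr rfl fun k hk ↦ ?_
  obtain ⟨l, rfl⟩ := Nat.exists_eq_add_of_le (Finset.mem_range_succ_iff.1 hk)
  have htri : ∀ m : ℕ, 2 * (m.choose 2 : ℤ) = m * (m - 1) := by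
    intro m
    induction m with
    | zero => simp
    | succ m ih =>
      rw [Nat.choose_succ_succ' m 1, Nat.choose_one_right]
      push_cast
      linarith
  have hl : k + l + 1 - 1 - k = l := by omega
  have hl' : k + l - k = l := by omega
  have hu : 2 * (k + l) + 1 - (k + l + 1 + k) = l := by omega
  have hd : 2 * (k + l) + 1 - l = 2 * k + l + 1 := by omega
  have e1 : (k + l + 1 + k).choose 2 + (k + l) * l =
      (k + l).choose 2 + (k + l) + (k + l) * (k + l) + (k + 1).choose 2 := by
    have h1 := htri (k + l + 1 + k)
    have h2 := htri (k + l)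
    have h3 := htri (k + 1)
    zify
    push_cast at h1 h2 h3
    linarith
  have e2 : l.choose 2 + (k + l) * (2 * k + l + 1) =
      (k + l).choose 2 + (k + l) + (k + l) * (k + l) + (k + 1).choose 2 := by
    have h1 := htri l
    have h2 := htri (k + l)
    have h3 := htri (k + 1)
    zify
    push_cast at h1 h2 h3
    linarith
  rw [hl, hl', hu, hd, e1, e2, pow_add q _ ((k + 1).choose 2)]
  have hs : (-1 : R) ^ l = (-1) ^ (k + l) * (-1) ^ k := by
    rw [← pow_add, show k + l + k = l + 2 * k by ring, pow_add, pow_mul]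
    simp
  rw [hs]
  push_cast
  ring

open Polynomial in
theorem X_pow_dvd_qPochhammer_sub {m n : ℕ} (h : m ≤ n) :
    (X : ℤ[X]) ^ (m + 1) ∣ qPochhammer X n - qPochhammer X m := by
  induction n, h using Nat.le_induction with
  | base => simp
  | succ n hmn ih =>
    rw [qPochhammer_succ]
    have : (X : ℤ[X]) ^ (m + 1) ∣ qPochhammer X n * X ^ (n + 1) :=
      (pow_dvd_pow X (by omega)).mul_left _
    convert ih.sub this using 1
    ring

open Polynomial in
theorem isCoprime_X_pow_qPochhammer (m n : ℕ) :
    IsCoprime ((X : ℤ[X]) ^ m) (qPochhammer X n) := by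
  refine IsCoprime.pow_left (IsCoprime.prod_right fun i hi ↦ ?_)
  obtain ⟨i, rfl⟩ := Nat.exists_eq_succ_of_ne_zero
    (Nat.one_le_iff_ne_zero.1 (Finset.mem_Icc.1 hi).1)
  exact ⟨X ^ i, 1, by simp [Nat.succ_eq_add_one]; ring⟩

open Polynomial in
theorem X_pow_dvd_qPochhammer_mul_gaussBinom_sub_one {n i j s : ℕ} (hi : s ≤ i) (hj : s ≤ j)
    (hn : s ≤ n) :
    (X : ℤ[X]) ^ (s + 1) ∣ qPochhammer X n * gaussBinom X (i + j) j - 1 := by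
  refine (isCoprime_X_pow_qPochhammer (s + 1) s).dvd_of_dvd_mul_left
    ((isCoprime_X_pow_qPochhammer (s + 1) s).dvd_of_dvd_mul_left ?_)
  have h := qPochhammer_mul_qPochhammer_mul_gaussBinom (X : ℤ[X]) i j
  obtain ⟨a, ha⟩ := X_pow_dvd_qPochhammer_sub hi
  obtain ⟨b, hb⟩ := X_pow_dvd_qPochhammer_sub hj
  obtain ⟨c, hc⟩ := X_pow_dvd_qPochhammer_sub hn
  obtain ⟨d, hd⟩ := X_pow_dvd_qPochhammer_sub (show s ≤ i + j by omega)
  rw [sub_eq_iff_eq_add] at ha hb hc hd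
  rw [ha, hb, hd] at h
  rw [hc]
  generalize (X : ℤ[X]) ^ (s + 1) = Y at *
  generalize qPochhammer (X : ℤ[X]) s = P at *
  generalize gaussBinom (X : ℤ[X]) (i + j) j = G at *
  refine ⟨P * d + P ^ 2 * c * G - P * G * (b * a * Y + b * P + P * a), ?_⟩
  linear_combination P * h

open Polynomial in
/-- Jacobi's identity for the cube of the Euler product. -/
theorem coeff_qPochhammer_pow_three (n : ℕ) :
    ((qPochhammer (X : ℤ[X]) n) ^ 3).coeff n =
      ∑ k ∈ Finset.range (n + 1),
        if n = (k + 1).choose 2 then (-1 : ℤ) ^ k * (2 * k + 1) else 0 := by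
  have hdvd : (X : ℤ[X]) ^ (n + 1) ∣ (qPochhammer (X : ℤ[X]) n) ^ 3 -
      ∑ k ∈ Finset.range (n + 1), C ((-1 : ℤ) ^ k * (2 * k + 1)) * X ^ ((k + 1).choose 2) := by
    rw [pow_succ (qPochhammer _ _), ← sum_range_mul_gaussBinom (q := (X : ℤ[X])) X_ne_zero, Finset.sum_mul,
      ← Finset.sum_sub_distrib]
    refine Finset.dvd_sum fun k hk ↦ ?_
    have hk' := Finset.mem_range_succ_iff.1 hk
    have h1 := X_pow_dvd_qPochhammer_mul_gaussBinom_sub_one (n := n) (i := n - k) (j := n + 1 + k)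
      (s := n - k) le_rfl (by omega) (by omega)
    have h2 := X_pow_dvd_qPochhammer_mul_gaussBinom_sub_one (n := n) (i := n + 1 + k) (j := n - k)
      (s := n - k) (by omega) le_rfl (by omega)
    rw [show n - k + (n + 1 + k) = 2 * n + 1 by omega] at h1
    rw [show n + 1 + k + (n - k) = 2 * n + 1 by omega] at h2
    have hle : n + 1 ≤ (k + 1).choose 2 + (n - k + 1) := by
      rw [Nat.choose_succ_succ' k 1, Nat.choose_one_right]
      omega
    refine (pow_dvd_pow X hle).trans ?_
    rw [pow_add]
    have h3 := mul_dvd_mul_left ((X : ℤ[X]) ^ ((k + 1).choose 2)) <| Dvd.dvd.mul_left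
      (dvd_sub (h1.mul_left ((n : ℤ[X]) + 1 + k)) (h2.mul_left ((n : ℤ[X]) - k))) ((-1) ^ k)
    convert h3 using 1
    simp only [map_mul, map_pow, map_neg, map_one, map_add, map_ofNat, map_natCast]
    ring
  have h0 := X_pow_dvd_iff.1 hdvd n (Nat.lt_succ_self n)
  rw [coeff_sub, sub_eq_zero] at h0
  rw [h0, finsetSum_coeff]
  exact Finset.sum_congr rfl fun k _ ↦ coeff_C_mul_X_pow _ _ _

theorem isSquare_or_eq_zero_of_multiplicative {f : ℕ → ℤ}
    (hfmul : ∀ m n : ℕ, Nat.Coprime m n → f (m * n) = f m * f n)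
    (hf0 : ∀ p r : ℕ, p.Prime → 1 ≤ r → ¬Even r → f (p ^ r) = 0) (n : ℕ) :
    IsSquare n ∨ f n = 0 := by
  induction n using Nat.recOnPosPrimePosCoprime with
  | zero => exact Or.inl ⟨0, rfl⟩
  | one => exact Or.inl ⟨1, rfl⟩
  | prime_pow p r hp hr =>
    by_cases h : Even r
    · exact Or.inl (h.isSquare_pow p)
    · exact Or.inr (hf0 p r hp hr h)
  | coprime a b _ _ hab iha ihb =>
    rcases iha with ha | ha
    · rcases ihb with hb | hb
      · exact Or.inl (ha.mul hb)
      · exact Or.inr (by rw [hfmul a b hab, hb, mul_zero])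
    · exact Or.inr (by rw [hfmul a b hab, ha, zero_mul])

theorem apply_sq_eq_χ₄_mul {f : ℕ → ℤ} (hf1 : f 1 = 1)
    (hfmul : ∀ m n : ℕ, Nat.Coprime m n → f (m * n) = f m * f n)
    (hfp : ∀ p r : ℕ, p.Prime → Odd p → 1 ≤ r → f (p ^ (2 * r)) = (ZMod.χ₄ p * p) ^ r)
    (m : ℕ) (hm : Odd m) : f (m ^ 2) = ZMod.χ₄ m * m := by
  induction m using Nat.recOnPosPrimePosCoprime with
  | zero => simp at hm
  | one => simp [hf1]
  | prime_pow p r hp hr =>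
    have hp' : Odd p := (Nat.odd_pow_iff hr.ne').1 hm
    rw [← pow_mul, mul_comm r, hfp p r hp hp' hr, mul_pow]
    push_cast
    rw [map_pow]
  | coprime a b _ _ hab iha ihb =>
    obtain ⟨ha, hb⟩ := Nat.odd_mul.1 hm
    rw [mul_pow, hfmul _ _ (hab.pow 2 2), iha ha, ihb hb]
    push_cast
    rw [map_mul]
    ring

/-- With `a n` the coefficient of `q^n` in `∏ (1 - q^m)^3`, and `f` the
multiplicative function with the stated values on prime powers, we have
`a n = f (8 n + 1)` for all `n`. -/
theorem stmt_11 (a : ℕ → ℤ)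
    (ha : ∀ n N : ℕ, n ≤ N →
      a n = (((∏ m ∈ Finset.Icc 1 N, ((1 : Polynomial ℤ) - Polynomial.X ^ m)) ^ 3).coeff n))
    (f : ℕ → ℤ)
    (hf1 : f 1 = 1)
    (hfmul : ∀ m n : ℕ, Nat.Coprime m n → f (m * n) = f m * f n)
    (hfa : ∀ p r : ℕ, p.Prime → 1 ≤ r → p % 4 = 1 → Even r →
      f (p ^ r) = (p : ℤ) ^ (r / 2))
    (hfb : ∀ p r : ℕ, p.Prime → 1 ≤ r → p % 4 = 3 → Even r →
      f (p ^ r) = (-1) ^ (r / 2) * (p : ℤ) ^ (r / 2))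
    (hf0 : ∀ p r : ℕ, p.Prime → 1 ≤ r →
      ¬((p % 4 = 1 ∨ p % 4 = 3) ∧ Even r) →
      f (p ^ r) = 0) :
    ∀ n : ℕ, a n = f (8 * n + 1) := by
  intro n
  rw [ha n n le_rfl]
  change ((qPochhammer (Polynomial.X : Polynomial ℤ) n) ^ 3).coeff n = _
  rw [coeff_qPochhammer_pow_three]
  have hchoose : ∀ k : ℕ, 8 * (k + 1).choose 2 + 1 = (2 * k + 1) ^ 2 := by
    intro k
    induction k with
    | zero => rfl
    | succ k ih =>
      rw [Nat.choose_succ_succ' (k + 1) 1, Nat.choose_one_right]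
      linarith
  have hfp : ∀ p r : ℕ, p.Prime → Odd p → 1 ≤ r → f (p ^ (2 * r)) = (ZMod.χ₄ p * p) ^ r := by
    intro p r hp hodd hr
    rcases Nat.odd_mod_four_iff.1 (Nat.odd_iff.1 hodd) with h | h
    · rw [hfa p (2 * r) hp (by omega) h (even_two_mul r), ZMod.χ₄_nat_one_mod_four h]
      simp
    · rw [hfb p (2 * r) hp (by omega) h (even_two_mul r), ZMod.χ₄_nat_three_mod_four h, mul_pow]
      simp
  rcases isSquare_or_eq_zero_of_multiplicative hfmul
    (fun p r hp hr h ↦ hf0 p r hp hr fun h' ↦ h h'.2) (8 * n + 1) with ⟨m, hm⟩ | h0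
  · have hodd : Odd m := (Nat.odd_mul.1 (show Odd (m * m) from hm ▸ ⟨4 * n, by ring⟩)).1
    obtain ⟨k, rfl⟩ := hodd
    rw [hm, ← sq, apply_sq_eq_χ₄_mul hf1 hfmul hfp _ ⟨k, rfl⟩,
      ZMod.χ₄_eq_neg_one_pow (by omega), show (2 * k + 1) / 2 = k by omega]
    have hk := hchoose k
    have hnk : n = (k + 1).choose 2 := by rw [sq] at hk; omega
    rw [Finset.sum_eq_single_of_mem k, if_pos hnk]
    · push_cast
      ring
    · rw [Finset.mem_range_succ_iff, hnk, Nat.choose_succ_succ' k 1, Nat.choose_one_right]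
      omega
    · intro j _ hj
      refine if_neg fun h ↦ hj ?_
      have := hchoose j
      rw [← h, hnk, hk, Nat.pow_left_inj two_ne_zero] at this
      omega
  · rw [h0]
    refine Finset.sum_eq_zero fun k _ ↦ if_neg fun h ↦ ?_
    have hk := hchoose k
    rw [← h] at hk
    rw [hk, apply_sq_eq_χ₄_mul hf1 hfmul hfp _ ⟨k, rfl⟩, ZMod.χ₄_eq_neg_one_pow (by omega)] at h0
    have : ((2 * k + 1 : ℕ) : ℤ) ≠ 0 := by positivity
    simp_all
end
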